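/- For a real number T > 0 define r : [0, T) → ℝ by r(t) = 1 + (√2 − 1)·√(2t/T) for 0 ≤ t < T/2 and r(t) = (T/(T − t))^{1/2} for T/2 ≤ t < T, and let r′ denote its derivative (defined on (0,T) except at t = T/2). Then ∫₀^T (r′(t)/r(t)²)·ln( r′(t)/(r(t) − 1) ) dt ≤ −ln T + 5/2. -/

import Mathlib

open MeasureTheory Set

/-- Fundamental theorem of calculus on an open interval for a linear combination of two
nonnegative derivatives, with integrability as part of the conclusion. -/
theorem integrableOn_and_integral_Ioo_eq_sub_of_nonneg {a b c : ℝ} (hab : a ≤ b)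
    {G H g h f : ℝ → ℝ}
    (hG : ContinuousOn G (Icc a b)) (hH : ContinuousOn H (Icc a b))
    (hG' : ∀ t ∈ Ioo a b, HasDerivAt G (g t) t) (hH' : ∀ t ∈ Ioo a b, HasDerivAt H (h t) t)
    (hg : ∀ t ∈ Ioo a b, 0 ≤ g t) (hh : ∀ t ∈ Ioo a b, 0 ≤ h t)
    (hf : ∀ t ∈ Ioo a b, f t = g t + c * h t) :
    IntegrableOn f (Ioo a b) ∧
      ∫ t in Ioo a b, f t = (G b - G a) + c * (H b - H a) := by
  have ig := intervalIntegral.integrableOn_deriv_of_nonneg hG hG' hg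
  have ih := intervalIntegral.integrableOn_deriv_of_nonneg hH hH' hh
  have ef := intervalIntegral.integral_eq_sub_of_hasDerivAt_of_le hab hG hG'
    ((intervalIntegrable_iff_integrableOn_Ioc_of_le hab).2 ig)
  have eh := intervalIntegral.integral_eq_sub_of_hasDerivAt_of_le hab hH hH'
    ((intervalIntegrable_iff_integrableOn_Ioc_of_le hab).2 ih)
  rw [intervalIntegral.integral_of_le hab, integral_Ioc_eq_integral_Ioo] at ef eh
  have ig' := ig.mono_set Ioo_subset_Ioc_self
  have ih' := ih.mono_set Ioo_subset_Ioc_self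
  refine ⟨IntegrableOn.congr_fun (ig'.add (ih'.const_mul c))
    (fun t ht => (hf t ht).symm) measurableSet_Ioo, ?_⟩
  rw [setIntegral_congr_fun measurableSet_Ioo hf, integral_add ig' (ih'.const_mul c),
    integral_const_mul, ef, eh]

/-- Numerical bound for the scale-free part of the integral. -/
theorem log_two_add_three_mul_add_le :
    Real.log 2 + 3 * (√2 / 2) + (1 - √2 / 2) * Real.log (1 - √2 / 2) ≤ 5 / 2 := by
  have h1 : √2 < 1.41422 := by rw [Real.sqrt_lt' (by norm_num)]; norm_num
  have h2 : 1.4142 < √2 := by rw [Real.lt_sqrt (by norm_num)]; norm_num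
  have hl := Real.log_two_lt_d9
  have he := Real.exp_one_lt_d9
  have hpos : 0 < 1 - √2 / 2 := by linarith
  have key : Real.log (1 - √2 / 2) ≤ -1.2 := by
    have := Real.log_le_sub_one_of_pos (mul_pos (Real.exp_pos 1) hpos)
    rw [Real.log_mul (Real.exp_pos 1).ne' hpos.ne', Real.log_exp] at this
    nlinarith
  nlinarith

/-- The contribution of the interval where `r` is affine in `√t`. -/
theorem integral_sqrt_piece (T : ℝ) (hT : 0 < T) (r r' : ℝ → ℝ)
    (hr : ∀ t < T / 2, r t = 1 + (√2 - 1) * √(2 * t / T))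
    (hr' : ∀ t ∈ Ioo 0 (T / 2), HasDerivAt r (r' t) t) :
    IntegrableOn (fun t => (r' t / (r t) ^ 2) * Real.log (r' t / (r t - 1))) (Ioo 0 (T / 2)) ∧
    ∫ t in Ioo 0 (T / 2), (r' t / (r t) ^ 2) * Real.log (r' t / (r t - 1))
      = Real.log 2 - Real.log T * (1 - √2 / 2) := by
  obtain ⟨a, ha⟩ : ∃ a, a = √2 - 1 := ⟨_, rfl⟩
  have hs : √2 ^ 2 = 2 := Real.sq_sqrt (by norm_num)
  have ha0 : 0 < a := by
    rw [ha, sub_pos, Real.lt_sqrt (by norm_num)]; norm_num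
  rw [← ha] at hr
  have hu0 : ∀ t ∈ Ioo 0 (T / 2), 0 < √(2 * t / T) := fun t ht =>
    Real.sqrt_pos.2 (div_pos (by linarith [ht.1]) hT)
  have hu1 : ∀ t ∈ Ioo 0 (T / 2), √(2 * t / T) < 1 := fun t ht => by
    rw [Real.sqrt_lt' one_pos, div_lt_iff₀ hT]; linarith [ht.2]
  have hden : ∀ t, 1 + a * √(2 * t / T) ≠ 0 := fun t => by positivity
  have hu : ∀ t ∈ Ioo 0 (T / 2),
      HasDerivAt (fun t => √(2 * t / T)) (1 / (T * √(2 * t / T))) t := fun t ht => by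
    have h0 := hu0 t ht
    have h1 : HasDerivAt (fun t : ℝ => 2 * t / T) (2 * 1 / T) t :=
      ((hasDerivAt_id' t).const_mul 2).div_const T
    refine HasDerivAt.congr_deriv (h1.sqrt (Real.sqrt_pos.1 h0).ne') ?_
    field_simp
  have hr'eq : ∀ t ∈ Ioo 0 (T / 2), r' t = a / (T * √(2 * t / T)) := fun t ht => by
    refine (hr' t ht).unique (HasDerivAt.congr_of_eventuallyEq
      (f := fun t => 1 + a * √(2 * t / T)) ?_ ?_)
    · refine HasDerivAt.congr_deriv (((hu t ht).const_mul a).const_add 1) ?_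
      ring
    · filter_upwards [Iio_mem_nhds ht.2] with x hx using hr x hx
  have cu : Continuous fun t => √(2 * t / T) := by fun_prop
  have cl : Continuous fun t => √(2 * t / T) * Real.log √(2 * t / T) :=
    Real.continuous_mul_log.comp cu
  have main := integrableOn_and_integral_Ioo_eq_sub_of_nonneg (a := 0) (b := T / 2)
    (c := -Real.log T) (by positivity)
    (G := fun t => -2 * a * (√(2 * t / T) * Real.log √(2 * t / T)) / (1 + a * √(2 * t / T))
      + 2 * Real.log (1 + a * √(2 * t / T)))
    (H := fun t => -(1 + a * √(2 * t / T))⁻¹)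
    (g := fun t => a / (T * √(2 * t / T)) / (1 + a * √(2 * t / T)) ^ 2
      * (-2 * Real.log √(2 * t / T)))
    (h := fun t => a / (T * √(2 * t / T)) / (1 + a * √(2 * t / T)) ^ 2)
    (f := fun t => (r' t / (r t) ^ 2) * Real.log (r' t / (r t - 1)))
    ?_ ?_ ?_ ?_ ?_ ?_ ?_
  · refine ⟨main.1, main.2.trans ?_⟩
    have e : 2 * (T / 2) / T = 1 := by field_simp
    have e2 : (1 + a) = √2 := by rw [ha]; ring
    simp only [e, mul_zero, zero_div, Real.sqrt_zero, Real.sqrt_one, Real.log_one, mul_one,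
      add_zero, e2]
    rw [Real.log_sqrt (by norm_num)]
    have : (√2)⁻¹ = √2 / 2 := by field_simp; linarith
    rw [this]; ring
  · exact ((((continuous_const.mul cl).div (by fun_prop) hden)).add
      (continuous_const.mul (Continuous.log (by fun_prop) hden))).continuousOn
  · exact (Continuous.inv₀ (by fun_prop) hden).neg.continuousOn
  · intro t ht
    have h0 := hu0 t ht
    have hd := hden t
    have h1 := hu t ht
    have h2 := (h1.const_mul a).const_add 1
    refine HasDerivAt.congr_deriv ((((h1.mul (h1.log h0.ne')).const_mul (-2 * a)).div h2 hd).add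
      ((h2.log hd).const_mul 2)) ?_
    simp only [Pi.mul_apply]
    field_simp
    ring
  · intro t ht
    have h0 := hu0 t ht
    have hd := hden t
    refine HasDerivAt.congr_deriv (((((hu t ht).const_mul a).const_add 1).inv hd).neg) ?_
    field_simp
  · intro t ht
    have h0 := hu0 t ht
    have := Real.log_neg h0 (hu1 t ht)
    exact mul_nonneg (by positivity) (by linarith)
  · intro t ht
    positivity
  · intro t ht
    have h0 := hu0 t ht
    rw [hr'eq t ht, hr t ht.2]
    have : a / (T * √(2 * t / T)) / (1 + a * √(2 * t / T) - 1)
        = (T * √(2 * t / T) ^ 2)⁻¹ := by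
      rw [add_sub_cancel_left]; generalize √(2 * t / T) = u at *; field_simp
    rw [this, Real.log_inv, Real.log_mul hT.ne' (by positivity), Real.log_pow]
    push_cast
    ring

/-- The contribution of the interval where `r t = √(T / (T - t))`. -/
theorem integral_inv_sqrt_piece (T : ℝ) (hT : 0 < T) (r r' : ℝ → ℝ)
    (hr : ∀ t, T / 2 ≤ t → r t = √(T / (T - t)))
    (hr' : ∀ t ∈ Ioo (T / 2) T, HasDerivAt r (r' t) t) :
    IntegrableOn (fun t => (r' t / (r t) ^ 2) * Real.log (r' t / (r t - 1))) (Ioo (T / 2) T) ∧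
    ∫ t in Ioo (T / 2) T, (r' t / (r t) ^ 2) * Real.log (r' t / (r t - 1))
      = 3 * (√2 / 2) + (1 - √2 / 2) * Real.log (1 - √2 / 2) - Real.log T * (√2 / 2) := by
  have hv0 : ∀ t ∈ Ioo (T / 2) T, 0 < √((T - t) / T) := fun t ht =>
    Real.sqrt_pos.2 (div_pos (by linarith [ht.2]) hT)
  have hv1 : ∀ t ∈ Ioo (T / 2) T, √((T - t) / T) < 1 := fun t ht => by
    rw [Real.sqrt_lt' one_pos, div_lt_iff₀ hT]; linarith [ht.1]
  have hv2 : ∀ t ∈ Ioo (T / 2) T, √((T - t) / T) ^ 2 ≤ 1 / 2 := fun t ht => by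
    rw [Real.sq_sqrt (div_pos (by linarith [ht.2]) hT).le, div_le_iff₀ hT]; linarith [ht.1]
  have hv : ∀ t ∈ Ioo (T / 2) T,
      HasDerivAt (fun t => √((T - t) / T)) (-(1 / (2 * T * √((T - t) / T)))) t := fun t ht => by
    have h0 := hv0 t ht
    have h1 : HasDerivAt (fun t : ℝ => (T - t) / T) (-1 / T) t :=
      ((hasDerivAt_id' t).const_sub T).div_const T
    refine HasDerivAt.congr_deriv (h1.sqrt (Real.sqrt_pos.1 h0).ne') ?_
    field_simp
  have hrv : ∀ t, T / 2 ≤ t → r t = (√((T - t) / T))⁻¹ := fun t ht => by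
    rw [hr t ht, ← Real.sqrt_inv, inv_div]
  have hr'eq : ∀ t ∈ Ioo (T / 2) T, r' t = 1 / (2 * T * √((T - t) / T) ^ 3) := fun t ht => by
    have h0 := hv0 t ht
    refine (hr' t ht).unique (HasDerivAt.congr_of_eventuallyEq
      (f := fun t => (√((T - t) / T))⁻¹) ?_ ?_)
    · refine HasDerivAt.congr_deriv ((hv t ht).inv h0.ne') ?_
      generalize √((T - t) / T) = v at *
      field_simp
    · filter_upwards [Ioi_mem_nhds ht.1] with x hx using hrv x (le_of_lt hx)
  have cv : Continuous fun t => √((T - t) / T) := by fun_prop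
  have cl : Continuous fun t => √((T - t) / T) * Real.log √((T - t) / T) :=
    Real.continuous_mul_log.comp cv
  have cl' : Continuous fun t => (1 - √((T - t) / T)) * Real.log (1 - √((T - t) / T)) :=
    Real.continuous_mul_log.comp (continuous_const.sub cv)
  have main := integrableOn_and_integral_Ioo_eq_sub_of_nonneg (a := T / 2) (b := T)
    (c := -Real.log T) (by linarith)
    (G := fun t => √((T - t) / T) * (Real.log 2 - 3)
      + 2 * (√((T - t) / T) * Real.log √((T - t) / T))
      - (1 - √((T - t) / T)) * Real.log (1 - √((T - t) / T)))
    (H := fun t => -√((T - t) / T))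
    (g := fun t => 1 / (2 * T * √((T - t) / T))
      * (-Real.log (2 * (√((T - t) / T) ^ 2 * (1 - √((T - t) / T))))))
    (h := fun t => 1 / (2 * T * √((T - t) / T)))
    (f := fun t => (r' t / (r t) ^ 2) * Real.log (r' t / (r t - 1)))
    ?_ ?_ ?_ ?_ ?_ ?_ ?_
  · refine ⟨main.1, main.2.trans ?_⟩
    have e : (T - T / 2) / T = 2⁻¹ := by field_simp; norm_num
    have e2 : √(2⁻¹ : ℝ) = √2 / 2 := by
      have hs : √2 ^ 2 = 2 := Real.sq_sqrt (by norm_num)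
      rw [Real.sqrt_inv]; field_simp; linarith
    have e3 : Real.log (√2 / 2) = -(Real.log 2 / 2) := by
      rw [← e2, Real.log_sqrt (by norm_num), Real.log_inv]; ring
    simp only [e, e2, e3, sub_self, zero_div, Real.sqrt_zero, Real.log_zero, sub_zero,
      Real.log_one]
    ring
  · exact (((cv.mul continuous_const).add (continuous_const.mul cl)).sub cl').continuousOn
  · exact cv.neg.continuousOn
  · intro t ht
    have h0 := hv0 t ht
    have h1 : 0 < 1 - √((T - t) / T) := sub_pos.2 (hv1 t ht)
    have d := hv t ht
    have d1 := d.const_sub 1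
    refine HasDerivAt.congr_deriv
      (((d.mul_const (Real.log 2 - 3)).add ((d.mul (d.log h0.ne')).const_mul 2)).sub
      (d1.mul (d1.log h1.ne'))) ?_
    rw [Real.log_mul (by norm_num) (by positivity), Real.log_mul (by positivity) h1.ne',
      Real.log_pow]
    push_cast
    generalize √((T - t) / T) = v at *
    field_simp
    ring
  · intro t ht
    refine HasDerivAt.congr_deriv ((hv t ht).neg) ?_
    ring
  · intro t ht
    have h0 := hv0 t ht
    have h1 : 0 < 1 - √((T - t) / T) := sub_pos.2 (hv1 t ht)
    refine mul_nonneg (by positivity) (neg_nonneg.2 (Real.log_nonpos (by positivity) ?_))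
    nlinarith [hv2 t ht, mul_le_mul_of_nonneg_right (hv2 t ht) h1.le]
  · intro t ht
    positivity
  · intro t ht
    have h0 := hv0 t ht
    have h1 : 0 < 1 - √((T - t) / T) := sub_pos.2 (hv1 t ht)
    rw [hr'eq t ht, hrv t ht.1.le]
    generalize √((T - t) / T) = v at *
    have e : 1 / (2 * T * v ^ 3) / (v⁻¹ - 1) = (T * (2 * (v ^ 2 * (1 - v))))⁻¹ := by
      have : v⁻¹ - 1 = (1 - v) / v := by field_simp
      rw [this]; field_simp
    rw [e, Real.log_inv, Real.log_mul hT.ne' (by positivity)]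
    field_simp
    ring

/-- For the Davies exponent function `r(t)`, one has
`∫₀ᵀ (r'(t)/r(t)²)·ln(r'(t)/(r(t)-1)) dt ≤ -ln T + 5/2`. -/
theorem integral_deriv_log_le
    (T : ℝ) (hT : 0 < T) (r r' : ℝ → ℝ)
    (hr : ∀ t, r t = if t < T / 2
        then 1 + (Real.sqrt 2 - 1) * Real.sqrt (2 * t / T)
        else Real.sqrt (T / (T - t)))
    (hr' : ∀ t ∈ Set.Ioo (0 : ℝ) T, t ≠ T / 2 → HasDerivAt r (r' t) t) :
    ∫ t in Set.Ioo (0 : ℝ) T, (r' t / (r t) ^ 2) * Real.log (r' t / (r t - 1))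
      ≤ -Real.log T + 5 / 2 := by
  obtain ⟨i1, e1⟩ := integral_sqrt_piece T hT r r'
    (fun t ht => by rw [hr, if_pos ht])
    (fun t ht => hr' t ⟨ht.1, by linarith [ht.2]⟩ ht.2.ne)
  obtain ⟨i2, e2⟩ := integral_inv_sqrt_piece T hT r r'
    (fun t ht => by rw [hr, if_neg ht.not_gt])
    (fun t ht => hr' t ⟨by linarith [ht.1], ht.2⟩ ht.1.ne')
  rw [← integrableOn_Ioc_iff_integrableOn_Ioo] at i1
  rw [← integral_Ioc_eq_integral_Ioo] at e1
  rw [← Ioc_union_Ioo_eq_Ioo (by linarith : (0 : ℝ) ≤ T / 2) (by linarith : T / 2 < T),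
    setIntegral_union (Set.disjoint_left.2 fun x hx hy => hx.2.not_gt hy.1)
      measurableSet_Ioo i1 i2, e1, e2]
  linarith [log_two_add_three_mul_add_le]
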